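/- Let R be a UFD with field of fractions K, and let t ∈ R be nonzero and not a unit. Set F₁ = (X, Y + X²/t), F₂ = (X, Y + (t−1)X), G₁ = (X + (t+1)Y, Y), G₂ = (X − Y²/t, Y), polynomial maps over K, and let F = G₂∘F₂∘G₁∘F₁ (applying F₁ first), so that F = (X + (t+1)Y + 3X² − t³Y² − tX² − tX⁴ − 2t²XY + 2tXY − 2t²X²Y − 2tX³ + 2X³, t²Y + (t−1)X + tX²). Then F induces an R-algebra automorphism of R[X,Y], and this automorphism does not belong to Tame₂(R). -/

import Mathlib

noncomputable section

/-- A polynomial map `(P(X,Y), Q(X,Y))` of the plane, given by a pair of polynomials. -/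
abbrev PolyPair (K : Type*) [CommSemiring K] :=
  MvPolynomial (Fin 2) K × MvPolynomial (Fin 2) K

/-- Composition of polynomial maps: `pcomp G F = G ∘ F` (the map `F` is applied first). -/
def pcomp {K : Type*} [CommSemiring K] (G F : PolyPair K) : PolyPair K :=
  (MvPolynomial.aeval ![F.1, F.2] G.1, MvPolynomial.aeval ![F.1, F.2] G.2)

/-- The identity polynomial map `(X, Y)`. -/
def idPair (K : Type*) [CommSemiring K] : PolyPair K :=
  (MvPolynomial.X 0, MvPolynomial.X 1)

/-- All coefficients of `p` lie in (the image of) `R`. -/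
def CoeffsIn (R : Type*) {K : Type*} [CommSemiring R] [CommSemiring K] [Algebra R K]
    (p : MvPolynomial (Fin 2) K) : Prop :=
  ∀ m : Fin 2 →₀ ℕ, p.coeff m ∈ Set.range (algebraMap R K)

/-- `F ∈ Aut₂(R)`: the polynomial map `F` over `K` is invertible (hence corresponds to an
automorphism over `K`) and both coordinate polynomials of `F` and of its inverse have all
of their coefficients in `R`. -/
def MemAut2 (R : Type*) {K : Type*} [CommSemiring R] [CommSemiring K] [Algebra R K]
    (F : PolyPair K) : Prop :=
  CoeffsIn R F.1 ∧ CoeffsIn R F.2 ∧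
    ∃ G : PolyPair K, CoeffsIn R G.1 ∧ CoeffsIn R G.2 ∧
      pcomp F G = idPair K ∧ pcomp G F = idPair K

/-- The elementary polynomial map `(X, Y + p(X))`. -/
def elemF {K : Type*} [CommSemiring K] (p : Polynomial K) : PolyPair K :=
  (MvPolynomial.X 0, MvPolynomial.X 1 + Polynomial.aeval (MvPolynomial.X 0) p)

/-- The elementary polynomial map `(X + p(Y), Y)`. -/
def elemG {K : Type*} [CommSemiring K] (p : Polynomial K) : PolyPair K :=
  (MvPolynomial.X 0 + Polynomial.aeval (MvPolynomial.X 1) p, MvPolynomial.X 1)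





/-- `σ` is an affine automorphism of `S[X₁,…,Xₙ]`:
`Xᵢ ↦ Σⱼ aᵢⱼ Xⱼ + bᵢ` with `(aᵢⱼ) ∈ GLₙ(S)` and `bᵢ ∈ S`. -/
def IsAffineAut {S : Type*} [CommRing S] {n : ℕ}
    (σ : MvPolynomial (Fin n) S ≃ₐ[S] MvPolynomial (Fin n) S) : Prop :=
  ∃ M : Matrix (Fin n) (Fin n) S, IsUnit M.det ∧ ∃ b : Fin n → S,
    ∀ i, σ (MvPolynomial.X i) =
      (∑ j, MvPolynomial.C (M i j) * MvPolynomial.X j) + MvPolynomial.C (b i)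

/-- `σ` is an elementary automorphism of `S[X₁,…,Xₙ]`: it sends one variable `Xᵢ` to
`Xᵢ + f` where `f` is a polynomial in the remaining variables, and fixes the others. -/
def IsElementaryAut {S : Type*} [CommRing S] {n : ℕ}
    (σ : MvPolynomial (Fin n) S ≃ₐ[S] MvPolynomial (Fin n) S) : Prop :=
  ∃ (i : Fin n) (f : MvPolynomial (Fin n) S),
    f ∈ MvPolynomial.supported S {j | j ≠ i} ∧
    σ (MvPolynomial.X i) = MvPolynomial.X i + f ∧
    ∀ j, j ≠ i → σ (MvPolynomial.X j) = MvPolynomial.X j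

/-- The tame subgroup `Tameₙ(S)` of the group of `S`-algebra automorphisms of
`S[X₁,…,Xₙ]`, generated by the affine and the elementary automorphisms. -/
def TameSubgroup (S : Type*) [CommRing S] (n : ℕ) :
    Subgroup (MvPolynomial (Fin n) S ≃ₐ[S] MvPolynomial (Fin n) S) :=
  Subgroup.closure {σ | IsAffineAut σ ∨ IsElementaryAut σ}

/-- `SL_m(S[X₁,…,Xₙ]) = E_m(S[X₁,…,Xₙ])` for all `n, m ≥ 0`: every matrix of
determinant one over every polynomial ring over `S` is a product of elementary
matrices (transvections). -/
def SLeqE (S : Type*) [CommRing S] : Prop :=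
  ∀ (n m : ℕ) (M : Matrix.SpecialLinearGroup (Fin m) (MvPolynomial (Fin n) S)),
    M ∈ Subgroup.closure {A : Matrix.SpecialLinearGroup (Fin m) (MvPolynomial (Fin n) S) |
      ∃ (i j : Fin m) (c : MvPolynomial (Fin n) S), i ≠ j ∧
        (A : Matrix (Fin m) (Fin m) (MvPolynomial (Fin n) S)) = Matrix.transvection i j c}


/-- `F` is stably tame over `R`: for some `m ≥ 0`, the automorphism of
`R[X, Y, Z₁,…,Z_m]` acting as `F` on `X, Y` and fixing `Z₁,…,Z_m` is tame. -/
def StablyTame (R : Type*) {K : Type*} [CommRing R] [CommRing K] [Algebra R K]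
    (F : PolyPair K) : Prop :=
  ∃ (m : ℕ) (σ : MvPolynomial (Fin (2 + m)) R ≃ₐ[R] MvPolynomial (Fin (2 + m)) R),
    σ ∈ TameSubgroup R (2 + m) ∧
    MvPolynomial.map (algebraMap R K) (σ (MvPolynomial.X (Fin.castAdd m 0))) =
      MvPolynomial.rename (Fin.castAdd m) F.1 ∧
    MvPolynomial.map (algebraMap R K) (σ (MvPolynomial.X (Fin.castAdd m 1))) =
      MvPolynomial.rename (Fin.castAdd m) F.2 ∧
    ∀ i : Fin m, σ (MvPolynomial.X (Fin.natAdd 2 i)) = MvPolynomial.X (Fin.natAdd 2 i)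

noncomputable section

/-- The length four polynomial map `F = G₂∘F₂∘G₁∘F₁` over `K = Frac(R)`, where
`F₁ = (X, Y + X²/t)`, `F₂ = (X, Y + (t−1)X)`, `G₁ = (X + (t+1)Y, Y)`,
`G₂ = (X − Y²/t, Y)`. -/
def exampleMap2 {R : Type*} [CommRing R] [IsDomain R] (t : R) :
    PolyPair (FractionRing R) :=
  let f := algebraMap R (FractionRing R)
  let F₁ := elemF (Polynomial.C (f t)⁻¹ * Polynomial.X ^ 2)
  let F₂ := elemF (Polynomial.C (f (t - 1)) * Polynomial.X)
  let G₁ := elemG (Polynomial.C (f (t + 1)) * Polynomial.X)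
  let G₂ := elemG (-(Polynomial.C (f t)⁻¹ * Polynomial.X ^ 2))
  pcomp G₂ (pcomp F₂ (pcomp G₁ F₁))

/-- The pair `(p', q')` is the image of `(p, q)` under an affine automorphism over `R`. -/
def AffineRel (R : Type*) [CommRing R] {A : Type*} [CommRing A] [Algebra R A]
    (p q p' q' : A) : Prop :=
  ∃ a b c d e f : R, IsUnit (a * d - b * c) ∧
    p' = algebraMap R A a * p + algebraMap R A b * q + algebraMap R A e ∧
    q' = algebraMap R A c * p + algebraMap R A d * q + algebraMap R A f

namespace AffineRel

variable {R A : Type*} [CommRing R] [CommRing A] [Algebra R A]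

lemma refl (p q : A) : AffineRel R p q p q :=
  ⟨1, 0, 0, 1, 0, 0, by simp, by simp, by simp⟩

lemma swap (p q : A) : AffineRel R p q q p :=
  ⟨0, 1, 1, 0, 0, 0, by simp, by simp, by simp⟩

lemma trans {p q p' q' p'' q'' : A} (h : AffineRel R p q p' q')
    (h' : AffineRel R p' q' p'' q'') : AffineRel R p q p'' q'' := by
  obtain ⟨a, b, c, d, e, f, hu, rfl, rfl⟩ := h
  obtain ⟨a', b', c', d', e', f', hu', rfl, rfl⟩ := h'
  refine ⟨a' * a + b' * c, a' * b + b' * d, c' * a + d' * c, c' * b + d' * d,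
    a' * e + b' * f + e', c' * e + d' * f + f', ?_, ?_, ?_⟩
  · convert hu'.mul hu using 1
    ring
  · simp only [map_add, map_mul]
    ring
  · simp only [map_add, map_mul]
    ring

lemma symm {p q p' q' : A} (h : AffineRel R p q p' q') : AffineRel R p' q' p q := by
  obtain ⟨a, b, c, d, e, f, hu, rfl, rfl⟩ := h
  obtain ⟨u, hu⟩ := hu.exists_right_inv
  have hA : algebraMap R A ((a * d - b * c) * u) = 1 := by rw [hu, map_one]
  simp only [map_mul, map_sub] at hA
  refine ⟨u * d, -(u * b), -(u * c), u * a, u * (b * f - d * e), u * (c * e - a * f), ?_, ?_, ?_⟩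
  · exact IsUnit.of_mul_eq_one (a * d - b * c)
      (by linear_combination (u * (a * d - b * c) + 1) * hu)
  · simp only [map_mul, map_neg, map_sub]
    linear_combination (-p) * hA
  · simp only [map_mul, map_neg, map_sub]
    linear_combination (-q) * hA

lemma add_aeval_of_natDegree_lt_two (p q : A) {g : Polynomial R} (hg : g.natDegree < 2) :
    AffineRel R p q (p + Polynomial.aeval q g) q := by
  refine ⟨1, g.coeff 1, 0, 1, g.coeff 0, 0, by simp, ?_, by simp⟩
  conv_lhs => rw [Polynomial.eq_X_add_C_of_natDegree_le_one (Nat.lt_succ_iff.mp hg)]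
  simp
  ring

end AffineRel

/-- Pairs obtained from `(x, y)` by affine maps and degree-raising elementary maps over `R`. -/
inductive DegreeTame (R : Type*) [CommRing R] {S : Type*} [CommRing S] [Algebra R S]
    (x y : Polynomial S) : Polynomial S → Polynomial S → Prop
  | affine {p q : Polynomial S} (h : AffineRel R x y p q) : DegreeTame R x y p q
  | step {p q p' q' : Polynomial S} (f : Polynomial R) (h : DegreeTame R x y p q)
      (hpq : p.natDegree ≤ q.natDegree) (hq : 1 ≤ q.natDegree) (hf : 2 ≤ f.natDegree)
      (h' : AffineRel R (p + Polynomial.aeval q f) q p' q') : DegreeTame R x y p' q'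

section Degree

variable {R S : Type*} [CommRing R] [CommRing S] [IsDomain S] [Algebra R S] [FaithfulSMul R S]

lemma natDegree_aeval_polynomial (q : Polynomial S) (f : Polynomial R) :
    (Polynomial.aeval q f).natDegree = f.natDegree * q.natDegree := by
  have h : Polynomial.aeval q f = (f.map (algebraMap R S)).comp q := by
    rw [Polynomial.comp, Polynomial.eval₂_map, Polynomial.aeval_def]
    rfl
  rw [h, Polynomial.natDegree_comp,
    Polynomial.natDegree_map_eq_of_injective (FaithfulSMul.algebraMap_injective R S)]

lemma natDegree_add_aeval {p q : Polynomial S} {f : Polynomial R}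
    (hpq : p.natDegree ≤ q.natDegree) (hq : 1 ≤ q.natDegree) (hf : 2 ≤ f.natDegree) :
    (p + Polynomial.aeval q f).natDegree = f.natDegree * q.natDegree := by
  rw [Polynomial.natDegree_add_eq_right_of_natDegree_lt, natDegree_aeval_polynomial]
  rw [natDegree_aeval_polynomial]
  nlinarith

lemma natDegree_affine_le {R S : Type*} [CommRing R] [CommRing S] [Algebra R S] (a b e : R)
    (p q : Polynomial S) (h : q.natDegree ≤ p.natDegree) :
    (algebraMap R (Polynomial S) a * p + algebraMap R (Polynomial S) b * q +
      algebraMap R (Polynomial S) e).natDegree ≤ p.natDegree := by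
  simp only [IsScalarTower.algebraMap_apply R S (Polynomial S), Polynomial.algebraMap_eq]
  rw [Polynomial.natDegree_add_C]
  exact (Polynomial.natDegree_add_le _ _).trans
    (max_le (Polynomial.natDegree_C_mul_le _ _) ((Polynomial.natDegree_C_mul_le _ _).trans h))

lemma natDegree_affine_eq {a : R} (ha : a ≠ 0) (b e : R) {p q : Polynomial S}
    (h : q.natDegree < p.natDegree) :
    (algebraMap R (Polynomial S) a * p + algebraMap R (Polynomial S) b * q +
      algebraMap R (Polynomial S) e).natDegree = p.natDegree := by
  simp only [IsScalarTower.algebraMap_apply R S (Polynomial S), Polynomial.algebraMap_eq]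
  have ha' : algebraMap R S a ≠ 0 := by simpa using ha
  rw [Polynomial.natDegree_add_C, Polynomial.natDegree_add_eq_left_of_natDegree_lt,
    Polynomial.natDegree_C_mul ha']
  rw [Polynomial.natDegree_C_mul ha']
  exact (Polynomial.natDegree_C_mul_le _ _).trans_lt h

end Degree

namespace DegreeTame

variable {R S : Type*} [CommRing R] [CommRing S] [Algebra R S] {x y p q p' q' : Polynomial S}

lemma trans_affine (h : DegreeTame R x y p q) (h' : AffineRel R p q p' q') :
    DegreeTame R x y p' q' := by
  cases h with
  | affine h => exact .affine (h.trans h')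
  | step f h hpq hq hf h'' => exact .step f h hpq hq hf (h''.trans h')

variable [IsDomain S] [FaithfulSMul R S]

lemma add_aeval [Nontrivial R]
    (hxy : ∀ a b e : R, a ≠ 0 ∨ b ≠ 0 →
      (algebraMap R (Polynomial S) a * x + algebraMap R (Polynomial S) b * y +
        algebraMap R (Polynomial S) e).natDegree = 1)
    (h : DegreeTame R x y p q) (g : Polynomial R) :
    DegreeTame R x y (p + Polynomial.aeval q g) q := by
  rcases lt_or_ge g.natDegree 2 with hg | hg
  · exact h.trans_affine (.add_aeval_of_natDegree_lt_two p q hg)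
  have h₀ := h
  cases h with
  | affine h =>
    obtain ⟨a, b, c, d, e, f, hu, rfl, rfl⟩ := h
    have hab : a ≠ 0 ∨ b ≠ 0 := by
      by_contra! hab
      simp [hab] at hu
    have hcd : c ≠ 0 ∨ d ≠ 0 := by
      by_contra! hcd
      simp [hcd] at hu
    exact .step g h₀ (by rw [hxy _ _ _ hab, hxy _ _ _ hcd]) (by rw [hxy _ _ _ hcd]) hg (.refl _ _)
  | @step p₀ q₀ _ _ k h hpq hq hk h' =>
    obtain ⟨a, b, c, d, e, f, hu, hp, rfl⟩ := h'
    have hdeg := natDegree_add_aeval hpq hq hk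
    have hlt : q₀.natDegree < (p₀ + Polynomial.aeval q₀ k).natDegree := by
      rw [hdeg]
      nlinarith
    by_cases hc : c = 0
    · subst hc
      have had : IsUnit (a * d) := by simpa using hu
      obtain ⟨u, hau⟩ := (isUnit_of_mul_isUnit_left had).exists_right_inv
      have hA : algebraMap R (Polynomial S) a * algebraMap R (Polynomial S) u = 1 := by
        rw [← map_mul, hau, map_one]
      let k' : Polynomial R := k + Polynomial.C u * (Polynomial.C b * Polynomial.X +
        Polynomial.C e + g.comp (Polynomial.C d * Polynomial.X + Polynomial.C f))
      have key : AffineRel R (p₀ + Polynomial.aeval q₀ k') q₀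
          (p + Polynomial.aeval (algebraMap R (Polynomial S) 0 * (p₀ + Polynomial.aeval q₀ k) +
            algebraMap R (Polynomial S) d * q₀ + algebraMap R (Polynomial S) f) g)
          (algebraMap R (Polynomial S) 0 * (p₀ + Polynomial.aeval q₀ k) +
            algebraMap R (Polynomial S) d * q₀ + algebraMap R (Polynomial S) f) := by
        refine ⟨a, 0, 0, d, 0, f, by simpa using hu, ?_, by simp⟩
        simp only [k', hp, map_add, map_mul, map_zero, Polynomial.aeval_C, Polynomial.aeval_X,
          Polynomial.aeval_comp, zero_mul, zero_add, add_zero]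
        linear_combination (-(algebraMap R (Polynomial S) b * q₀ + algebraMap R (Polynomial S) e +
          Polynomial.aeval (algebraMap R (Polynomial S) d * q₀ +
            algebraMap R (Polynomial S) f) g)) * hA
      rcases lt_or_ge k'.natDegree 2 with hk' | hk'
      · exact (h.trans_affine (.add_aeval_of_natDegree_lt_two p₀ q₀ hk')).trans_affine key
      · exact .step k' h hpq hq hk' key
    · have hq' := natDegree_affine_eq hc d f hlt
      refine .step g h₀ ?_ ?_ hg (.refl _ _)
      · rw [hq', hp]
        exact natDegree_affine_le _ _ _ _ _ hlt.le
      · rw [hq']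
        omega

end DegreeTame

section Tame

variable {R : Type*} [CommRing R]

lemma IsAffineAut.affineRel {σ : MvPolynomial (Fin 2) R ≃ₐ[R] MvPolynomial (Fin 2) R}
    (h : IsAffineAut σ) :
    AffineRel R (MvPolynomial.X 0) (MvPolynomial.X 1)
      (σ (MvPolynomial.X 0)) (σ (MvPolynomial.X 1)) := by
  obtain ⟨M, hM, b, h⟩ := h
  refine ⟨M 0 0, M 0 1, M 1 0, M 1 1, b 0, b 1, by rwa [Matrix.det_fin_two] at hM, ?_, ?_⟩ <;>
    simp [h, MvPolynomial.algebraMap_eq]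

lemma AffineRel.map {A B : Type*} [CommRing A] [CommRing B] [Algebra R A] [Algebra R B]
    {p q p' q' : A} (h : AffineRel R p q p' q') (φ : A →ₐ[R] B) :
    AffineRel R (φ p) (φ q) (φ p') (φ q') := by
  obtain ⟨a, b, c, d, e, f, hu, rfl, rfl⟩ := h
  exact ⟨a, b, c, d, e, f, hu, by simp, by simp⟩

lemma IsElementaryAut.exists_aeval {σ : MvPolynomial (Fin 2) R ≃ₐ[R] MvPolynomial (Fin 2) R}
    (h : IsElementaryAut σ) :
    ∃ (i j : Fin 2) (g : Polynomial R), i ≠ j ∧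
      σ (MvPolynomial.X i) = MvPolynomial.X i + Polynomial.aeval (MvPolynomial.X j) g ∧
      σ (MvPolynomial.X j) = MvPolynomial.X j := by
  obtain ⟨i, f, hf, hi, hj⟩ := h
  have hset : {j | j ≠ i} = {1 - i} := by
    ext j
    fin_cases i <;> fin_cases j <;> simp
  rw [hset, MvPolynomial.supported, Set.image_singleton,
    Algebra.adjoin_singleton_eq_range_aeval] at hf
  obtain ⟨g, rfl⟩ := hf
  have hne : 1 - i ≠ i := by fin_cases i <;> simp
  exact ⟨i, 1 - i, g, hne.symm, hi, hj _ hne⟩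

lemma DegreeTame.of_mem_tameSubgroup [Nontrivial R] {S : Type*} [CommRing S] [IsDomain S]
    [Algebra R S] [FaithfulSMul R S] (φ : MvPolynomial (Fin 2) R →ₐ[R] Polynomial S)
    (hφ : ∀ a b e : R, a ≠ 0 ∨ b ≠ 0 →
      (algebraMap R (Polynomial S) a * φ (MvPolynomial.X 0) +
        algebraMap R (Polynomial S) b * φ (MvPolynomial.X 1) +
        algebraMap R (Polynomial S) e).natDegree = 1)
    {σ : MvPolynomial (Fin 2) R ≃ₐ[R] MvPolynomial (Fin 2) R} (hσ : σ ∈ TameSubgroup R 2) :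
    DegreeTame R (φ (MvPolynomial.X 0)) (φ (MvPolynomial.X 1))
      (φ (σ (MvPolynomial.X 0))) (φ (σ (MvPolynomial.X 1))) := by
  have elementary : ∀ (τ ρ : MvPolynomial (Fin 2) R ≃ₐ[R] MvPolynomial (Fin 2) R)
      (i j : Fin 2) (g : Polynomial R), i ≠ j →
      ρ (MvPolynomial.X i) = MvPolynomial.X i + Polynomial.aeval (MvPolynomial.X j) g →
      ρ (MvPolynomial.X j) = MvPolynomial.X j →
      DegreeTame R (φ (MvPolynomial.X 0)) (φ (MvPolynomial.X 1))
        (φ (τ (MvPolynomial.X 0))) (φ (τ (MvPolynomial.X 1))) →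
      DegreeTame R (φ (MvPolynomial.X 0)) (φ (MvPolynomial.X 1))
        (φ ((τ * ρ) (MvPolynomial.X 0))) (φ ((τ * ρ) (MvPolynomial.X 1))) := by
    intro τ ρ i j g hij hi hj h
    have hadd : φ ((τ * ρ) (MvPolynomial.X i)) = φ (τ (MvPolynomial.X i)) +
        Polynomial.aeval (φ (τ (MvPolynomial.X j))) g := by
      rw [AlgEquiv.mul_apply, hi, map_add, map_add, ← Polynomial.aeval_algHom_apply,
        ← Polynomial.aeval_algHom_apply]
    have hfix : φ ((τ * ρ) (MvPolynomial.X j)) = φ (τ (MvPolynomial.X j)) := by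
      rw [AlgEquiv.mul_apply, hj]
    fin_cases i <;> fin_cases j <;> simp only [Fin.zero_eta, Fin.mk_one, Fin.isValue, ne_eq,
      not_true_eq_false] at hij hadd hfix
    · rw [hadd, hfix]
      exact h.add_aeval hφ g
    · rw [hadd, hfix]
      exact ((h.trans_affine (.swap _ _)).add_aeval hφ g).trans_affine (.swap _ _)
  induction hσ using Subgroup.closure_induction_right with
  | one => exact .affine (.refl _ _)
  | mul_right τ _ ρ hρ h =>
    rcases hρ with hρ | hρ
    · exact h.trans_affine (hρ.affineRel.map (φ.comp τ.toAlgHom))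
    · obtain ⟨i, j, g, hij, hi, hj⟩ := hρ.exists_aeval
      exact elementary τ ρ i j g hij hi hj h
  | mul_inv_cancel τ _ ρ hρ h =>
    rcases hρ with hρ | hρ
    · refine h.trans_affine ?_
      have := (hρ.affineRel.map (φ.comp (τ * ρ⁻¹).toAlgHom)).symm
      have hcancel : ∀ z, (τ * ρ⁻¹) (ρ z) = τ z := fun z => by
        rw [AlgEquiv.mul_apply, ← AlgEquiv.mul_apply ρ⁻¹ ρ, inv_mul_cancel, AlgEquiv.one_apply]
      simpa [hcancel] using this
    · obtain ⟨i, j, g, hij, hi, hj⟩ := hρ.exists_aeval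
      have hinv : ∀ z, ρ⁻¹ (ρ z) = z := fun z => by
        rw [← AlgEquiv.mul_apply, inv_mul_cancel, AlgEquiv.one_apply]
      have hj' : ρ⁻¹ (MvPolynomial.X j) = MvPolynomial.X j := by
        conv_lhs => rw [← hj]
        exact hinv _
      refine elementary τ ρ⁻¹ i j (-g) hij ?_ hj' h
      have := hinv (MvPolynomial.X i)
      rw [hi, map_add, ← Polynomial.aeval_algHom_apply, hj'] at this
      rw [map_neg, ← sub_eq_add_neg, eq_sub_iff_add_eq, this]

end Tame

/-- If `(p, q)` is obtained tamely over `R`, `q` has degree two and `p` degree four, then the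
leading coefficient of `p` is an `R`-multiple of the square of that of `q`. -/
lemma DegreeTame.exists_coeff_four_eq {R S : Type*} [CommRing R] [CommRing S] [IsDomain S]
    [Algebra R S] [FaithfulSMul R S] [Nontrivial R] {x y p q : Polynomial S}
    (hxy : ∀ a b e : R, a ≠ 0 ∨ b ≠ 0 →
      (algebraMap R (Polynomial S) a * x + algebraMap R (Polynomial S) b * y +
        algebraMap R (Polynomial S) e).natDegree = 1)
    (h : DegreeTame R x y p q) (hp : p.natDegree = 4) (hq : q.natDegree = 2) :
    ∃ r : R, p.coeff 4 = algebraMap R S r * q.coeff 2 ^ 2 := by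
  cases h with
  | affine h =>
    obtain ⟨a, b, c, d, e, f, hu, rfl, rfl⟩ := h
    have hab : a ≠ 0 ∨ b ≠ 0 := by
      by_contra! hab
      simp [hab] at hu
    rw [hxy _ _ _ hab] at hp
    omega
  | @step p₀ q₀ _ _ k h hpq hq₀ hk h' =>
    obtain ⟨a, b, c, d, e, f, hu, rfl, rfl⟩ := h'
    have hdeg := natDegree_add_aeval hpq hq₀ hk
    have hlt : q₀.natDegree < (p₀ + Polynomial.aeval q₀ k).natDegree := by
      rw [hdeg]
      nlinarith
    have hc : c = 0 := by
      by_contra hc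
      rw [natDegree_affine_eq hc d f hlt] at hq
      have := natDegree_affine_le (S := S) a b e _ _ hlt.le
      omega
    subst hc
    have had : IsUnit (a * d) := by simpa using hu
    have ha : a ≠ 0 := (isUnit_of_mul_isUnit_left had).ne_zero
    obtain ⟨v, hv⟩ := (isUnit_of_mul_isUnit_right had).exists_right_inv
    have hd : algebraMap R S d ≠ 0 := by
      simpa using (isUnit_of_mul_isUnit_right had).ne_zero
    have hV : algebraMap R S d * algebraMap R S v = 1 := by rw [← map_mul, hv, map_one]
    rw [natDegree_affine_eq ha b e hlt, hdeg] at hp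
    simp only [IsScalarTower.algebraMap_apply R S (Polynomial S), Polynomial.algebraMap_eq,
      map_zero, zero_mul, zero_add, Polynomial.natDegree_add_C,
      Polynomial.natDegree_C_mul hd] at hq
    have hk2 : k.natDegree = 2 := by
      rw [hq] at hp
      omega
    have hk' : Polynomial.aeval q₀ k =
        Polynomial.C (algebraMap R S (k.coeff 2)) * q₀ ^ 2 +
          Polynomial.C (algebraMap R S (k.coeff 1)) * q₀ +
          Polynomial.C (algebraMap R S (k.coeff 0)) := by
      rw [Polynomial.aeval_eq_sum_range, hk2]
      simp [Finset.sum_range_succ, Algebra.smul_def,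
        IsScalarTower.algebraMap_apply R S (Polynomial S)]
      ring
    have hsq : (q₀ ^ 2).coeff 4 = q₀.coeff 2 ^ 2 :=
      Polynomial.coeff_pow_of_natDegree_le (m := 2) (n := 2) hq.le
    have hp4 : p₀.coeff 4 = 0 := Polynomial.coeff_eq_zero_of_natDegree_lt (by omega)
    have hq4 : q₀.coeff 4 = 0 := Polynomial.coeff_eq_zero_of_natDegree_lt (by omega)
    refine ⟨a * k.coeff 2 * v ^ 2, ?_⟩
    simp only [IsScalarTower.algebraMap_apply R S (Polynomial S), Polynomial.algebraMap_eq,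
      hk', Polynomial.coeff_add, Polynomial.coeff_C_mul, hsq, hp4, hq4, Polynomial.coeff_C,
      map_zero, map_mul, map_pow]
    simp
    linear_combination (-(algebraMap R S a * algebraMap R S (k.coeff 2) * q₀.coeff 2 ^ 2) *
      (algebraMap R S d * algebraMap R S v + 1)) * hV

section Example

open MvPolynomial

variable {R : Type*} [CommRing R]

/-- The polynomial map `exampleMap2 t`, with coefficients in `R`. -/
def examplePair (t : R) : PolyPair R :=
  (X 0 + (C t + 1) * X 1 + (3 - C t) * X 0 ^ 2 - C t * (C t * X 1 + X 0 ^ 2) ^ 2 -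
      2 * (C t - 1) * X 0 * (C t * X 1 + X 0 ^ 2),
    C t * (C t * X 1 + X 0 ^ 2) + (C t - 1) * X 0)

/-- The inverse of the polynomial map `examplePair t`. -/
def examplePairInv (t : R) : PolyPair R :=
  (C t * (C t * X 0 + X 1 ^ 2) - (C t + 1) * X 1,
    X 1 - (C t - 1) * X 0 - (C t + 3) * X 1 ^ 2 - C t * (C t * X 0 + X 1 ^ 2) ^ 2 +
      2 * (C t + 1) * X 1 * (C t * X 0 + X 1 ^ 2))

lemma pcomp_examplePair_examplePairInv (t : R) :
    pcomp (examplePair t) (examplePairInv t) = idPair R := by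
  ext1 <;>
    simp only [pcomp, examplePair, examplePairInv, idPair, map_add, map_sub, map_mul, map_pow,
      map_one, map_ofNat, aeval_X, aeval_C, algebraMap_eq, Matrix.cons_val_zero,
      Matrix.cons_val_one] <;>
    ring

lemma pcomp_examplePairInv_examplePair (t : R) :
    pcomp (examplePairInv t) (examplePair t) = idPair R := by
  ext1 <;>
    simp only [pcomp, examplePair, examplePairInv, idPair, map_add, map_sub, map_mul, map_pow,
      map_one, map_ofNat, aeval_X, aeval_C, algebraMap_eq, Matrix.cons_val_zero,
      Matrix.cons_val_one] <;>
    ring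

/-- The automorphism of `R[X, Y]` induced by `examplePair t`. -/
def exampleAut (t : R) : MvPolynomial (Fin 2) R ≃ₐ[R] MvPolynomial (Fin 2) R :=
  AlgEquiv.ofAlgHom (aeval ![(examplePair t).1, (examplePair t).2])
    (aeval ![(examplePairInv t).1, (examplePairInv t).2])
    (by
      have h := pcomp_examplePairInv_examplePair t
      apply MvPolynomial.algHom_ext
      intro i
      fin_cases i
      · simpa [pcomp, idPair] using congrArg Prod.fst h
      · simpa [pcomp, idPair] using congrArg Prod.snd h)
    (by
      have h := pcomp_examplePair_examplePairInv t
      apply MvPolynomial.algHom_ext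
      intro i
      fin_cases i
      · simpa [pcomp, idPair] using congrArg Prod.fst h
      · simpa [pcomp, idPair] using congrArg Prod.snd h)

lemma exampleAut_X_zero (t : R) : exampleAut t (X 0) = (examplePair t).1 := by
  simp [exampleAut]

lemma exampleAut_X_one (t : R) : exampleAut t (X 1) = (examplePair t).2 := by
  simp [exampleAut]

lemma exampleMap2_eq [IsDomain R] {t : R} (ht : t ≠ 0) :
    exampleMap2 t = (map (algebraMap R (FractionRing R)) (examplePair t).1,
      map (algebraMap R (FractionRing R)) (examplePair t).2) := by
  have ht' : algebraMap R (FractionRing R) t ≠ 0 := by simpa using ht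
  have hC : C (σ := Fin 2) (algebraMap R (FractionRing R) t)⁻¹ *
      C (algebraMap R (FractionRing R) t) = 1 := by
    rw [← C_mul, inv_mul_cancel₀ ht', C_1]
  have h2 : (exampleMap2 t).2 = map (algebraMap R (FractionRing R)) (examplePair t).2 := by
    simp [exampleMap2, pcomp, elemF, elemG, examplePair, algebraMap_eq]
    linear_combination (C (algebraMap R (FractionRing R) t) * X 0 ^ 2) * hC
  ext1
  · simp [exampleMap2, pcomp, elemF, elemG, examplePair, algebraMap_eq]
    set s := C (σ := Fin 2) (algebraMap R (FractionRing R) t)⁻¹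
    set T := C (σ := Fin 2) (algebraMap R (FractionRing R) t)
    linear_combination ((3 - T) * X 0 ^ 2 - T * (T * X 1 + X 0 ^ 2) ^ 2 -
      2 * (T - 1) * X 0 * (T * X 1 + X 0 ^ 2) -
      2 * s * T * X 0 ^ 2 * (T * (T * X 1 + X 0 ^ 2) + (T - 1) * X 0) -
      s * (s * T - 1) * T ^ 2 * X 0 ^ 4) * hC
  · exact h2

lemma CoeffsIn.map_algebraMap {K : Type*} [CommRing K] [Algebra R K]
    (p : MvPolynomial (Fin 2) R) : CoeffsIn R (map (algebraMap R K) p) :=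
  fun m => ⟨p.coeff m, (coeff_map _ _ _).symm⟩

lemma pcomp_map {K : Type*} [CommRing K] [Algebra R K] (G F : PolyPair R) :
    pcomp (map (algebraMap R K) G.1, map (algebraMap R K) G.2)
        (map (algebraMap R K) F.1, map (algebraMap R K) F.2) =
      (map (algebraMap R K) (pcomp G F).1, map (algebraMap R K) (pcomp G F).2) := by
  have key : ∀ p : MvPolynomial (Fin 2) R,
      aeval ![map (algebraMap R K) F.1, map (algebraMap R K) F.2] (map (algebraMap R K) p) =
        map (algebraMap R K) (aeval ![F.1, F.2] p) := by
    intro p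
    rw [aeval_map_algebraMap]
    have h := comp_aeval_apply (f := ![F.1, F.2]) (mapAlgHom (σ := Fin 2) (Algebra.ofId R K)) p
    have hv : (fun i => mapAlgHom (σ := Fin 2) (Algebra.ofId R K) (![F.1, F.2] i)) =
        ![map (algebraMap R K) F.1, map (algebraMap R K) F.2] := by
      funext i
      fin_cases i <;> rfl
    rw [hv] at h
    exact h.symm
  ext1
  · exact key G.1
  · exact key G.2

lemma exampleAut_notMem_tameSubgroup [IsDomain R] {t : R} (ht : t ≠ 0) (htu : ¬IsUnit t) :
    exampleAut t ∉ TameSubgroup R 2 := by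
  intro hσ
  let φ : MvPolynomial (Fin 2) R →ₐ[R] Polynomial (Polynomial R) :=
    aeval ![Polynomial.X, Polynomial.C Polynomial.X * Polynomial.X]
  have hφ : ∀ a b e : R, a ≠ 0 ∨ b ≠ 0 →
      (algebraMap R (Polynomial (Polynomial R)) a * φ (X 0) +
        algebraMap R (Polynomial (Polynomial R)) b * φ (X 1) +
        algebraMap R (Polynomial (Polynomial R)) e).natDegree = 1 := by
    intro a b e hab
    have hlin : algebraMap R (Polynomial (Polynomial R)) a * φ (X 0) +
        algebraMap R (Polynomial (Polynomial R)) b * φ (X 1) +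
        algebraMap R (Polynomial (Polynomial R)) e =
        Polynomial.C (Polynomial.C b * Polynomial.X + Polynomial.C a) * Polynomial.X +
          Polynomial.C (Polynomial.C e) := by
      simp [φ, Polynomial.algebraMap_apply]
      ring
    rw [hlin]
    apply Polynomial.natDegree_linear
    intro h0
    have h1 := congrArg (fun s => Polynomial.coeff s 1) h0
    have h2 := congrArg (fun s => Polynomial.coeff s 0) h0
    simp at h1 h2
    tauto
  have h := DegreeTame.of_mem_tameSubgroup φ hφ hσ
  rw [exampleAut_X_zero, exampleAut_X_one] at h
  have hC : ∀ r : R, φ (C r) = Polynomial.C (Polynomial.C r) := fun r => by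
    simp [φ, Polynomial.algebraMap_apply]
  have hX : φ (X 0) = Polynomial.X := by simp [φ]
  have hY : φ (X 1) = Polynomial.C Polynomial.X * Polynomial.X := by simp [φ]
  have hP : φ (examplePair t).1 =
      Polynomial.C (Polynomial.C (-t)) * Polynomial.X ^ 4 +
      (Polynomial.C (2 * (1 - Polynomial.C t) - 2 * Polynomial.C t ^ 2 * Polynomial.X) *
        Polynomial.X ^ 3 +
      Polynomial.C (3 - Polynomial.C t - Polynomial.C (t ^ 3) * Polynomial.X ^ 2 -
        2 * (Polynomial.C t - 1) * Polynomial.C t * Polynomial.X) * Polynomial.X ^ 2 +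
      Polynomial.C (1 + Polynomial.C (t + 1) * Polynomial.X) * Polynomial.X +
      Polynomial.C 0) := by
    simp only [examplePair, map_add, map_sub, map_mul, map_pow, map_one, map_ofNat, hC, hX, hY]
    simp
    ring
  have hQ : φ (examplePair t).2 =
      Polynomial.C (Polynomial.C t) * Polynomial.X ^ 2 +
      Polynomial.C (Polynomial.C (t - 1) + Polynomial.C (t ^ 2) * Polynomial.X) * Polynomial.X +
      Polynomial.C 0 := by
    simp only [examplePair, map_add, map_sub, map_mul, map_pow, map_one, hC, hX, hY]
    simp
    ring
  obtain ⟨r, hr⟩ := h.exists_coeff_four_eq hφ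
    (by
      have ht' : (Polynomial.C (-t)) ≠ 0 := by simpa using ht
      rw [hP, Polynomial.natDegree_add_eq_left_of_natDegree_lt,
        Polynomial.natDegree_C_mul_X_pow _ _ ht']
      rw [Polynomial.natDegree_C_mul_X_pow _ _ ht']
      exact Polynomial.natDegree_cubic_le.trans_lt (by norm_num))
    (by
      rw [hQ]
      exact Polynomial.natDegree_quadratic (by simpa using ht))
  have hP4 : (φ (examplePair t).1).coeff 4 = Polynomial.C (-t) := by
    rw [hP, Polynomial.coeff_add, Polynomial.coeff_C_mul_X_pow, if_pos rfl,
      Polynomial.coeff_eq_zero_of_natDegree_lt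
        (Polynomial.natDegree_cubic_le.trans_lt (by norm_num)), add_zero]
  have hQ2 : (φ (examplePair t).2).coeff 2 = Polynomial.C t := by
    rw [hQ, Polynomial.coeff_add, Polynomial.coeff_add, Polynomial.coeff_C_mul_X_pow,
      Polynomial.coeff_C_mul_X, Polynomial.coeff_C]
    simp
  rw [hP4, hQ2, Polynomial.algebraMap_eq, ← Polynomial.C_pow, ← Polynomial.C_mul] at hr
  have hr' := Polynomial.C_injective hr
  exact htu (IsUnit.of_mul_eq_one (-r) (mul_left_cancel₀ ht (by linear_combination hr')))

end Example

/-- Let `R` be a UFD with fraction field `K` and `t ∈ R` nonzero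
and not a unit. With `F₁ = (X, Y + X²/t)`, `F₂ = (X, Y + (t−1)X)`,
`G₁ = (X + (t+1)Y, Y)`, `G₂ = (X − Y²/t, Y)` and `F = G₂∘F₂∘G₁∘F₁`, the map `F`
induces an `R`-algebra automorphism of `R[X,Y]` which is not in `Tame₂(R)`. -/
theorem stmt_13 {R : Type*} [CommRing R] [IsDomain R] [UniqueFactorizationMonoid R]
    (t : R) (ht : t ≠ 0) (htu : ¬IsUnit t) :
    MemAut2 R (exampleMap2 t) ∧
    ∃ σ : MvPolynomial (Fin 2) R ≃ₐ[R] MvPolynomial (Fin 2) R,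
      MvPolynomial.map (algebraMap R (FractionRing R)) (σ (MvPolynomial.X 0)) =
        (exampleMap2 t).1 ∧
      MvPolynomial.map (algebraMap R (FractionRing R)) (σ (MvPolynomial.X 1)) =
        (exampleMap2 t).2 ∧
      σ ∉ TameSubgroup R 2 := by
  have hF := exampleMap2_eq ht
  refine ⟨?_, exampleAut t, ?_, ?_, exampleAut_notMem_tameSubgroup ht htu⟩
  · rw [hF]
    refine ⟨.map_algebraMap _, .map_algebraMap _,
      (MvPolynomial.map (algebraMap R _) (examplePairInv t).1,
        MvPolynomial.map (algebraMap R _) (examplePairInv t).2),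
      .map_algebraMap _, .map_algebraMap _, ?_, ?_⟩
    · rw [pcomp_map, pcomp_examplePair_examplePairInv]
      simp [idPair]
    · rw [pcomp_map, pcomp_examplePairInv_examplePair]
      simp [idPair]
  · rw [hF, exampleAut_X_zero]
  · rw [hF, exampleAut_X_one]

end
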